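/- arXiv:2309.11965 — 2 statements merged into one kernel-verified Lean document; each statement's English description precedes it below -/
import Mathlib

section
/- Let the local plant be a deterministic finite automaton G_i with sub-automaton H_i generating the nonempty prefix-closed language P_i(K) = L(H_i) ⊆ L(G_i). If P_i(K) is CA-controllable (with respect to L(G_i), Σ_uc ∩ Σ_i, Σ_c^a ∩ Σ_i) and CA-observable (with respect to L(G_i), Σ_o ∩ Σ_i, Φ_i^a), then the state-estimate-based CA-supervisor S_{i,CA} achieves P_i(K), that is, L_a(S_{i,CA}^a/G_i) = P_i(K). -/
attribute [local instance] Classical.propDecidable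

noncomputable section

namespace DESCA

variable {E Q R : Type*}

/-- Natural projection onto a sub-alphabet `A`: erase all events not in `A`. -/
def proj (A : Set E) : List E → List E
  | [] => []
  | a :: s => if a ∈ A then a :: proj A s else proj A s

/-- A language is prefix-closed if it contains every prefix of each of its members. -/
def PrefixClosed (L : Set (List E)) : Prop :=
  ∀ s t : List E, s <+: t → t ∈ L → s ∈ L

/-- Prefix closure of a language. -/
def prefixClosure (L : Set (List E)) : Set (List E) :=
  {s | ∃ t ∈ L, s <+: t}

/-- Strings over the sub-alphabet `A`. -/
def Strings (A : Set E) : Set (List E) := {s | ∀ a ∈ s, a ∈ A}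

/-- Synchronous product of `L1 ⊆ A1*` and `L2 ⊆ A2*`:
`L1 ∥ L2 = P1⁻¹(L1) ∩ P2⁻¹(L2)`. -/
def sync (A1 A2 : Set E) (L1 L2 : Set (List E)) : Set (List E) :=
  {s | proj A1 s ∈ L1 ∧ proj A2 s ∈ L2}

/-- Actuator-attack alteration of a control pattern `g`:
`Δ(g) = {(g \ g') ∪ g'' : g', g'' ⊆ Eca}`. -/
def Delta (Eca : Set E) (g : Set E) : Set (Set E) :=
  {ga | ∃ g' g'', g' ⊆ Eca ∧ g'' ⊆ Eca ∧ ga = (g \ g') ∪ g''}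

/-- Large language `L_a(S^a/G)` of a single supervised system over alphabet `A`:
`ε` belongs to it, and for `s` in it and `σ ∈ A`, `s ++ [σ]` belongs to it iff
`s ++ [σ] ∈ LG` and (`σ` uncontrollable, or enabled by some attacked control
`g ∈ Sa w` for some observation `w ∈ Phi s`). -/
inductive LargeLang (A : Set E) (LG : Set (List E)) (Euc : Set E)
    (Phi : List E → Set (List E)) (Sa : List E → Set (Set E)) : List E → Prop
  | nil : LargeLang A LG Euc Phi Sa []
  | step {s : List E} {σ : E} :
      LargeLang A LG Euc Phi Sa s → σ ∈ A → s ++ [σ] ∈ LG →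
      (σ ∈ Euc ∨ ∃ w ∈ Phi s, ∃ g ∈ Sa w, σ ∈ g) →
      LargeLang A LG Euc Phi Sa (s ++ [σ])

/-- Large language `L_a((S1^a ∧ S2^a)/G)` of the conjunctively supervised system:
`ε` belongs to it, and for `s` in it and `σ`, `s ++ [σ]` belongs to it iff
`s ++ [σ] ∈ LG` and (`σ` uncontrollable or
`∃ w1 ∈ Phi1 s, ∃ w2 ∈ Phi2 s, ∃ g1 ∈ Sa1 w1, ∃ g2 ∈ Sa2 w2,`
`σ ∈ (g1 ∪ (Σ \ A1)) ∩ (g2 ∪ (Σ \ A2))`). -/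
inductive ConjLargeLang (A1 A2 : Set E) (LG : Set (List E)) (Euc : Set E)
    (Phi1 Phi2 : List E → Set (List E)) (Sa1 Sa2 : List E → Set (Set E)) :
    List E → Prop
  | nil : ConjLargeLang A1 A2 LG Euc Phi1 Phi2 Sa1 Sa2 []
  | step {s : List E} {σ : E} :
      ConjLargeLang A1 A2 LG Euc Phi1 Phi2 Sa1 Sa2 s → s ++ [σ] ∈ LG →
      (σ ∈ Euc ∨ ∃ w1 ∈ Phi1 s, ∃ w2 ∈ Phi2 s, ∃ g1 ∈ Sa1 w1, ∃ g2 ∈ Sa2 w2,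
        σ ∈ (g1 ∪ A1ᶜ) ∩ (g2 ∪ A2ᶜ)) →
      ConjLargeLang A1 A2 LG Euc Phi1 Phi2 Sa1 Sa2 (s ++ [σ])

/-- Run of a deterministic automaton with partial transition function. -/
def dfaRun (δ : Q → E → Option Q) : Q → List E → Option Q
  | q, [] => some q
  | q, σ :: s => (δ q σ).bind fun q' => dfaRun δ q' s

/-- Language generated by a DFA with partial transition function:
strings whose run from `q0` is defined. -/
def dfaLang (δ : Q → E → Option Q) (q0 : Q) : Set (List E) :=
  {s | (dfaRun δ q0 s).isSome}

/-- Restriction of the transition function to a sub-automaton with state set `QH`. -/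
def restrictDelta (δ : Q → E → Option Q) (QH : Set Q) (q : Q) (σ : E) : Option Q :=
  match δ q σ with
  | none => none
  | some q' => if q ∈ QH ∧ q' ∈ QH then some q' else none

/-- Concrete sensor-attack map `Θ^a` along the run from state `q`:
`Θ^a(σ1⋯σn) = L1 L2 ⋯ Ln` where `Lk = {σk}` for a non-attacked transition and
`Lk = A_tr` (the attack language of the transition) for an attacked transition
(those labeled by events in `Eoa`). -/
def Theta (δ : Q → E → Option Q) (Eoa : Set E) (Att : Q → E → Set (List E)) :
    Q → List E → Set (List E)
  | _, [] => {([] : List E)}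
  | q, σ :: s =>
    match δ q σ with
    | none => ∅
    | some q' =>
      {w | ∃ u v, u ∈ (if σ ∈ Eoa then Att q σ else {[σ]}) ∧
            v ∈ Theta δ Eoa Att q' s ∧ w = u ++ v}

/-- Observation map `Φ^a(s) = P(Θ^a(s))` of the concrete sensor-attack model,
projecting onto the observable events `Eo`. -/
def PhiOf (δ : Q → E → Option Q) (q0 : Q) (Eo Eoa : Set E)
    (Att : Q → E → Set (List E)) (s : List E) : Set (List E) :=
  proj Eo '' Theta δ Eoa Att q0 s

/-- CA-controllability of `K` w.r.t. plant language `LG` and event set `A`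
(`A` playing the role of `Σ_uc ∪ Σ_c^a`, possibly intersected with a local alphabet). -/
def CACont (K LG : Set (List E)) (A : Set E) : Prop :=
  ∀ s σ, s ∈ K → σ ∈ A → s ++ [σ] ∈ LG → s ++ [σ] ∈ K

/-- CA-observability of `K` w.r.t. plant language `LG` and observation map `Phi`. -/
def CAObs (K LG : Set (List E)) (Phi : List E → Set (List E)) : Prop :=
  ∀ s σ, s ++ [σ] ∈ K →
    ∃ w ∈ Phi s, ∀ s' ∈ LG, w ∈ Phi s' → s' ∈ K →
      s' ++ [σ] ∈ LG → s' ++ [σ] ∈ K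

/-- State estimate after observing `w`:
`E_H^a(w) = {q ∈ QH : ∃ s ∈ L(H), w ∈ Φ^a(s) ∧ δ_H(q0, s) = q}`. -/
def estimate (δH : Q → E → Option Q) (q0 : Q) (QH : Set Q)
    (Phi : List E → Set (List E)) (w : List E) : Set Q :=
  {q | q ∈ QH ∧ ∃ s, dfaRun δH q0 s = some q ∧ w ∈ Phi s}

/-- Disablement set: events leading from some estimated state to an illegal state. -/
def rho (δ : Q → E → Option Q) (QH : Set Q) (x : Set Q) : Set E :=
  {σ | ∃ q ∈ x, ∃ q', δ q σ = some q' ∧ q' ∉ QH}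

/-- State-estimate-based CA-supervisor:
`S_CA(w) = (Ei \ ρ(E_H^a(w))) ∪ (Euc ∩ Ei)` if `w ∈ Φ^a(L(H))`, else `Euc ∩ Ei`. -/
def CASup (δ δH : Q → E → Option Q) (q0 : Q) (QH : Set Q)
    (Phi : List E → Set (List E)) (Ei Euc : Set E) (w : List E) : Set E :=
  if ∃ s ∈ dfaLang δH q0, w ∈ Phi s then
    (Ei \ rho δ QH (estimate δH q0 QH Phi w)) ∪ (Euc ∩ Ei)
  else Euc ∩ Ei

/-- A (nondeterministic) automaton with ε-moves: transitions are labeled by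
`some σ` (an event) or `none` (ε). -/
structure ENFA (E : Type*) (Q : Type*) where
  start : Q
  step : Q → Option E → Q → Prop
  accept : Set Q

/-- `N.Reaches q s q'`: there is a run of the ε-NFA `N` from `q` to `q'`
reading the string `s`, interleaving arbitrarily many ε-moves. -/
inductive ENFA.Reaches (N : ENFA E Q) : Q → List E → Q → Prop
  | refl (q : Q) : ENFA.Reaches N q [] q
  | eps {q q' q'' : Q} {s : List E} :
      N.step q none q' → ENFA.Reaches N q' s q'' → ENFA.Reaches N q s q''
  | symb {q q' q'' : Q} {σ : E} {s : List E} :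
      N.step q (some σ) q' → ENFA.Reaches N q' s q'' →
      ENFA.Reaches N q (σ :: s) q''

/-- Marked language of an ε-NFA. -/
def ENFA.markedLang (N : ENFA E Q) : Set (List E) :=
  {s | ∃ q ∈ N.accept, N.Reaches N.start s q}

/-- Generated language of an ε-NFA: strings having at least one run from the start. -/
def ENFA.genLang (N : ENFA E Q) : Set (List E) :=
  {s | ∃ q, N.Reaches N.start s q}

/-- Attack language `A_tr = L_m(F_tr)` marked by the attack automaton attached to
the transition leaving `q` on event `σ`. -/
def Atr (Finit : Q → E → R) (Fd : Q → E → R → E → Option R)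
    (Fm : Q → E → Set R) (q : Q) (σ : E) : Set (List E) :=
  {t | ∃ r, dfaRun (Fd q σ) (Finit q σ) t = some r ∧ r ∈ Fm q σ}

/-- Transition relation of the extended automaton `G^a`: non-attacked transitions
are kept; each attacked transition `(q, σ, q')` (i.e. `σ ∈ Eoa` and `δ q σ` defined)
is replaced by an ε-transition from `q` into the attack automaton `F_tr`, the
transitions of `F_tr`, and ε-transitions from marked states of `F_tr` to `q'`. -/
inductive GaStep (δ : Q → E → Option Q) (Eoa : Set E)
    (Finit : Q → E → R) (Fd : Q → E → R → E → Option R) (Fm : Q → E → Set R) :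
    Q ⊕ Q × E × R → Option E → Q ⊕ Q × E × R → Prop
  | keep {q : Q} {σ : E} {q' : Q} :
      δ q σ = some q' → σ ∉ Eoa →
      GaStep δ Eoa Finit Fd Fm (Sum.inl q) (some σ) (Sum.inl q')
  | enter {q : Q} {σ : E} :
      σ ∈ Eoa → (δ q σ).isSome →
      GaStep δ Eoa Finit Fd Fm (Sum.inl q) none (Sum.inr (q, σ, Finit q σ))
  | inner {q : Q} {σ : E} {r : R} {τ : E} {r' : R} :
      σ ∈ Eoa → (δ q σ).isSome → Fd q σ r τ = some r' →
      GaStep δ Eoa Finit Fd Fm (Sum.inr (q, σ, r)) (some τ) (Sum.inr (q, σ, r'))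
  | exit {q : Q} {σ : E} {q' : Q} {r : R} :
      δ q σ = some q' → σ ∈ Eoa → r ∈ Fm q σ →
      GaStep δ Eoa Finit Fd Fm (Sum.inr (q, σ, r)) none (Sum.inl q')

/-- The extended ε-NFA `G^a`, whose marked states are the plant states. -/
def Ga (δ : Q → E → Option Q) (q0 : Q) (Eoa : Set E)
    (Finit : Q → E → R) (Fd : Q → E → R → E → Option R) (Fm : Q → E → Set R) :
    ENFA E (Q ⊕ Q × E × R) where
  start := Sum.inl q0
  step := GaStep δ Eoa Finit Fd Fm
  accept := Set.range Sum.inl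

/-- Relabel every transition labeled by an event not in `Eo` as an ε-transition,
keeping all other transitions and the marked states. -/
def relabel (Eo : Set E) (N : ENFA E Q) : ENFA E Q where
  start := N.start
  step := fun q a q' =>
    (∃ σ ∈ Eo, a = some σ ∧ N.step q (some σ) q') ∨
    (a = none ∧ (N.step q none q' ∨ ∃ σ, σ ∉ Eo ∧ N.step q (some σ) q'))
  accept := N.accept

theorem dfaRun_concat (δ : Q → E → Option Q) (q : Q) (s : List E) (σ : E) :
    dfaRun δ q (s ++ [σ]) = (dfaRun δ q s).bind fun q' => δ q' σ := by
  induction s generalizing q with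
  | nil => simp [dfaRun]
  | cons a s ih => cases h : δ q a <;> simp [dfaRun, h, ih]

theorem mem_dfaLang_iff {δ : Q → E → Option Q} {q0 : Q} {s : List E} :
    s ∈ dfaLang δ q0 ↔ ∃ q, dfaRun δ q0 s = some q :=
  Option.isSome_iff_exists

theorem concat_mem_dfaLang_iff {δ : Q → E → Option Q} {q0 : Q} {s : List E} {σ : E} :
    s ++ [σ] ∈ dfaLang δ q0 ↔ ∃ q q', dfaRun δ q0 s = some q ∧ δ q σ = some q' := by
  rw [mem_dfaLang_iff, dfaRun_concat]
  simp only [Option.bind_eq_some_iff]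
  exact exists_comm

theorem restrictDelta_eq_some_iff {δ : Q → E → Option Q} {QH : Set Q} {q q' : Q} {σ : E} :
    restrictDelta δ QH q σ = some q' ↔ δ q σ = some q' ∧ q ∈ QH ∧ q' ∈ QH := by
  unfold restrictDelta
  cases h : δ q σ with
  | none => simp
  | some p =>
    simp only [Option.ite_none_right_eq_some, Option.some.injEq]
    constructor
    · rintro ⟨hp, rfl⟩
      exact ⟨rfl, hp⟩
    · rintro ⟨rfl, hp⟩
      exact ⟨hp, rfl⟩

theorem dfaRun_of_restrictDelta {δ : Q → E → Option Q} {QH : Set Q} {q q' : Q} {s : List E}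
    (hq : q ∈ QH) (h : dfaRun (restrictDelta δ QH) q s = some q') :
    dfaRun δ q s = some q' ∧ q' ∈ QH := by
  induction s generalizing q with
  | nil =>
    obtain rfl : q = q' := by simpa [dfaRun] using h
    exact ⟨rfl, hq⟩
  | cons a s ih =>
    obtain ⟨p, hp, hs⟩ := Option.bind_eq_some_iff.1 h
    obtain ⟨ha, -, hpH⟩ := restrictDelta_eq_some_iff.1 hp
    obtain ⟨hrun, hq'⟩ := ih hpH hs
    exact ⟨Option.bind_eq_some_iff.2 ⟨p, ha, hrun⟩, hq'⟩

theorem mem_Delta_self (Eca g : Set E) : g ∈ Delta Eca g :=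
  ⟨∅, ∅, Set.empty_subset _, Set.empty_subset _, by simp⟩

/-- An event that the CA-supervisor enables after an observation of a legal string,
and that the plant can execute there, keeps the string legal. -/
theorem concat_mem_of_notMem_rho {δ : Q → E → Option Q} {q0 : Q} {QH : Set Q} (hq0 : q0 ∈ QH)
    {Phi : List E → Set (List E)} {s w : List E} {σ : E}
    (hs : s ∈ dfaLang (restrictDelta δ QH) q0) (hw : w ∈ Phi s)
    (hσ : σ ∉ rho δ QH (estimate (restrictDelta δ QH) q0 QH Phi w))
    (hG : s ++ [σ] ∈ dfaLang δ q0) : s ++ [σ] ∈ dfaLang (restrictDelta δ QH) q0 := by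
  obtain ⟨q, hq⟩ := mem_dfaLang_iff.1 hs
  obtain ⟨hrun, hqH⟩ := dfaRun_of_restrictDelta hq0 hq
  obtain ⟨p, q', hp, hq'⟩ := concat_mem_dfaLang_iff.1 hG
  obtain rfl : q = p := Option.some.inj (hrun.symm.trans hp)
  refine concat_mem_dfaLang_iff.2 ⟨q, q', hq, restrictDelta_eq_some_iff.2 ⟨hq', hqH, ?_⟩⟩
  by_contra hq'H
  exact hσ ⟨q, ⟨hqH, s, hq, hw⟩, q', hq', hq'H⟩

/-- If every legal string observed as `w` stays legal under `σ` whenever the plant can execute it,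
then `σ` is not disabled after `w`. -/
theorem notMem_rho_of_forall {δ : Q → E → Option Q} {q0 : Q} {QH : Set Q} (hq0 : q0 ∈ QH)
    {Phi : List E → Set (List E)} {w : List E} {σ : E}
    (h : ∀ s ∈ dfaLang δ q0, w ∈ Phi s → s ∈ dfaLang (restrictDelta δ QH) q0 →
      s ++ [σ] ∈ dfaLang δ q0 → s ++ [σ] ∈ dfaLang (restrictDelta δ QH) q0) :
    σ ∉ rho δ QH (estimate (restrictDelta δ QH) q0 QH Phi w) := by
  rintro ⟨q, ⟨-, s, hs, hw⟩, q', hq', hq'H⟩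
  have hrun := (dfaRun_of_restrictDelta hq0 hs).1
  obtain ⟨p, p', hp, hp'⟩ := concat_mem_dfaLang_iff.1 <|
    h s (mem_dfaLang_iff.2 ⟨q, hrun⟩) hw (mem_dfaLang_iff.2 ⟨q, hs⟩)
      (concat_mem_dfaLang_iff.2 ⟨q, q', hrun, hq'⟩)
  obtain rfl : q = p := Option.some.inj (hs.symm.trans hp)
  obtain ⟨hδ, -, hp'H⟩ := restrictDelta_eq_some_iff.1 hp'
  obtain rfl : q' = p' := Option.some.inj (hq'.symm.trans hδ)
  exact hq'H hp'H

/-- Theorem 5 of the paper: if the nonempty prefix-closed language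
`P_i(K) = L(H_i) ⊆ L(G_i)` is CA-controllable and CA-observable, then the
state-estimate-based CA-supervisor achieves it: `L_a(S_{i,CA}^a/G_i) = P_i(K)`. -/
theorem CASup_achieves_PiK {E Q : Type*} [Fintype E]
    (Eo Ec Eca : Set E) (hca : Eca ⊆ Ec)
    (Eoa : Set E) (hoa : Eoa ⊆ Eo)
    (δ : Q → E → Option Q) (q0 : Q) (QH : Set Q) (hq0 : q0 ∈ QH)
    (Att : Q → E → Set (List E))
    (hcont : CACont (dfaLang (restrictDelta δ QH) q0) (dfaLang δ q0)
      (Ecᶜ ∪ Eca))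
    (hobs : CAObs (dfaLang (restrictDelta δ QH) q0) (dfaLang δ q0)
      (PhiOf δ q0 Eo Eoa Att)) :
    {s | LargeLang Set.univ (dfaLang δ q0) Ecᶜ (PhiOf δ q0 Eo Eoa Att)
        (fun w => Delta Eca
          (CASup δ (restrictDelta δ QH) q0 QH (PhiOf δ q0 Eo Eoa Att)
            Set.univ Ecᶜ w)) s}
      = dfaLang (restrictDelta δ QH) q0 := by
  ext s
  constructor
  · intro hs
    induction hs with
    | nil => exact mem_dfaLang_iff.2 ⟨q0, rfl⟩
    | @step s σ _ _ hG hen ih =>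
      rcases hen with hu | ⟨w, hw, g, ⟨g', g'', -, hg'', rfl⟩, hσ⟩
      · exact hcont s σ ih (Or.inl hu) hG
      rcases hσ with ⟨hσ, -⟩ | hσ
      · rw [CASup, if_pos ⟨s, ih, hw⟩] at hσ
        rcases hσ with ⟨-, hσ⟩ | ⟨hu, -⟩
        · exact concat_mem_of_notMem_rho hq0 ih hw hσ hG
        · exact hcont s σ ih (Or.inl hu) hG
      · exact hcont s σ ih (Or.inr (hg'' hσ)) hG
  · intro hs
    induction s using List.reverseRecOn with
    | nil => exact LargeLang.nil
    | append_singleton s σ ih =>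
      obtain ⟨q, q', hq, -⟩ := concat_mem_dfaLang_iff.1 hs
      have hsK : s ∈ dfaLang (restrictDelta δ QH) q0 := mem_dfaLang_iff.2 ⟨q, hq⟩
      obtain ⟨p, hp⟩ := mem_dfaLang_iff.1 hs
      obtain ⟨w, hw, hobs_w⟩ := hobs s σ hs
      refine LargeLang.step (ih hsK) trivial
        (mem_dfaLang_iff.2 ⟨p, (dfaRun_of_restrictDelta hq0 hp).1⟩)
        (Or.inr ⟨w, hw, _, mem_Delta_self _ _, ?_⟩)
      rw [CASup, if_pos ⟨s, hsK, hw⟩]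
      exact Or.inl ⟨trivial, notMem_rho_of_forall hq0 hobs_w⟩

end DESCA

end
end

section
/- Under Assumption 1 (Φ_i^a(P_i(s)) = Φ_i^a(s) for all s ∈ L(G), i = 1,2) and nonemptiness of the observation maps (Φ_i^a(s) ≠ ∅ for s ∈ L(G) ∪ L(G_i)), if K ⊆ L(G) is conditionally decomposable (K = P1(K) ∥ P2(K)) and the local supervisors satisfy L_a(S_i^a/G_i) = P_i(K) for i = 1,2, then L_a((S1^a ∧ S2^a)/G) = K and L_a(S_i^a/G_i) ⊆ P_i(K) for i = 1,2. -/
attribute [local instance] Classical.propDecidable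

noncomputable section

namespace DESCA

variable {E Q R : Type*}

theorem proj_append (A : Set E) (s t : List E) :
    proj A (s ++ t) = proj A s ++ proj A t := by
  induction s with
  | nil => rfl
  | cons a s ih =>
    by_cases ha : a ∈ A <;> simp [proj, ha, ih]

theorem proj_concat_of_mem {A : Set E} {σ : E} (h : σ ∈ A) (s : List E) :
    proj A (s ++ [σ]) = proj A s ++ [σ] := by
  simp [proj_append, proj, h]

theorem proj_concat_of_notMem {A : Set E} {σ : E} (h : σ ∉ A) (s : List E) :
    proj A (s ++ [σ]) = proj A s := by
  simp [proj_append, proj, h]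

theorem Delta_nonempty (Eca g : Set E) : (Delta Eca g).Nonempty :=
  ⟨g, ∅, ∅, Set.empty_subset _, Set.empty_subset _, by simp⟩

section LargeLang

variable {A U : Set E} {LG : Set (List E)} {Phi : List E → Set (List E)}
  {Sa : List E → Set (Set E)} {s : List E} {σ : E}

theorem LargeLang.of_concat (h : LargeLang A LG U Phi Sa (s ++ [σ])) :
    LargeLang A LG U Phi Sa s ∧ (σ ∈ U ∨ ∃ w ∈ Phi s, ∃ g ∈ Sa w, σ ∈ g) := by
  generalize ht : s ++ [σ] = t at h
  cases h with
  | nil => simp at ht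
  | step hs _ _ hen =>
    obtain ⟨rfl, hσ⟩ := List.append_inj' ht rfl
    obtain rfl : σ = _ := by simpa using hσ
    exact ⟨hs, hen⟩

theorem LargeLang.proj_concat (h : LargeLang A LG U Phi Sa (proj A s))
    (hLG : proj A (s ++ [σ]) ∈ LG) (hPhi : Phi (proj A s) = Phi s)
    (hen : σ ∈ U ∨ ∃ w ∈ Phi s, ∃ g ∈ Sa w, σ ∈ g ∪ Aᶜ) :
    LargeLang A LG U Phi Sa (proj A (s ++ [σ])) := by
  by_cases hσ : σ ∈ A
  · rw [proj_concat_of_mem hσ] at hLG ⊢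
    refine .step h hσ hLG (hen.imp_right ?_)
    rintro ⟨w, hw, g, hg, hmem⟩
    exact ⟨w, hPhi ▸ hw, g, hg, hmem.resolve_right (not_not_intro hσ)⟩
  · rwa [proj_concat_of_notMem hσ]

theorem LargeLang.of_proj_concat (h : LargeLang A LG U Phi Sa (proj A (s ++ [σ]))) :
    LargeLang A LG U Phi Sa (proj A s) := by
  by_cases hσ : σ ∈ A
  · rw [proj_concat_of_mem hσ] at h
    exact h.of_concat.1
  · rwa [proj_concat_of_notMem hσ] at h

theorem LargeLang.enabled_of_proj_concat
    (h : LargeLang A LG U Phi Sa (proj A (s ++ [σ])))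
    (hPhi : Phi (proj A s) = Phi s) (hne : (Phi s).Nonempty)
    (hSa : ∀ w, (Sa w).Nonempty) :
    σ ∈ U ∨ ∃ w ∈ Phi s, ∃ g ∈ Sa w, σ ∈ g ∪ Aᶜ := by
  by_cases hσ : σ ∈ A
  · rw [proj_concat_of_mem hσ] at h
    refine h.of_concat.2.imp_right ?_
    rintro ⟨w, hw, g, hg, hmem⟩
    exact ⟨w, hPhi ▸ hw, g, hg, Or.inl hmem⟩
  · obtain ⟨w, hw⟩ := hne
    obtain ⟨g, hg⟩ := hSa w
    exact Or.inr ⟨w, hw, g, hg, Or.inr hσ⟩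

end LargeLang

/-- Under compatibility of the observation maps with the projections, the conjunction
large language is the synchronous product of the local large languages. -/
theorem conjLargeLang_iff {A1 A2 U : Set E} {LG1 LG2 : Set (List E)}
    {Phi1 Phi2 : List E → Set (List E)} {Sa1 Sa2 : List E → Set (Set E)}
    (hA1 : ∀ s ∈ sync A1 A2 LG1 LG2, Phi1 (proj A1 s) = Phi1 s)
    (hA2 : ∀ s ∈ sync A1 A2 LG1 LG2, Phi2 (proj A2 s) = Phi2 s)
    (hne1 : ∀ s ∈ sync A1 A2 LG1 LG2, (Phi1 s).Nonempty)
    (hne2 : ∀ s ∈ sync A1 A2 LG1 LG2, (Phi2 s).Nonempty)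
    (hSa1 : ∀ w, (Sa1 w).Nonempty) (hSa2 : ∀ w, (Sa2 w).Nonempty)
    (hsub : sync A1 A2 {s | LargeLang A1 LG1 U Phi1 Sa1 s}
      {s | LargeLang A2 LG2 U Phi2 Sa2 s} ⊆ sync A1 A2 LG1 LG2) (s : List E) :
    ConjLargeLang A1 A2 (sync A1 A2 LG1 LG2) U Phi1 Phi2 Sa1 Sa2 s ↔
      s ∈ sync A1 A2 {s | LargeLang A1 LG1 U Phi1 Sa1 s}
        {s | LargeLang A2 LG2 U Phi2 Sa2 s} := by
  constructor
  · intro h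
    induction h with
    | nil => exact ⟨.nil, .nil⟩
    | @step s σ _ hLG hen ih =>
      have hs := hsub ih
      refine ⟨ih.1.proj_concat hLG.1 (hA1 s hs) (hen.imp_right ?_),
        ih.2.proj_concat hLG.2 (hA2 s hs) (hen.imp_right ?_)⟩
      · rintro ⟨w1, hw1, _, _, g1, hg1, _, _, hmem⟩
        exact ⟨w1, hw1, g1, hg1, hmem.1⟩
      · rintro ⟨_, _, w2, hw2, _, _, g2, hg2, hmem⟩
        exact ⟨w2, hw2, g2, hg2, hmem.2⟩
  · induction s using List.reverseRecOn with
    | nil => exact fun _ => .nil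
    | append_singleton s σ ih =>
      intro h
      have hpre : s ∈ sync A1 A2 {s | LargeLang A1 LG1 U Phi1 Sa1 s}
          {s | LargeLang A2 LG2 U Phi2 Sa2 s} :=
        ⟨LargeLang.of_proj_concat h.1, LargeLang.of_proj_concat h.2⟩
      have hs := hsub hpre
      refine .step (ih hpre) (hsub h) ?_
      rcases LargeLang.enabled_of_proj_concat h.1 (hA1 s hs) (hne1 s hs) hSa1 with
        hU | ⟨w1, hw1, g1, hg1, hmem1⟩
      · exact Or.inl hU
      rcases LargeLang.enabled_of_proj_concat h.2 (hA2 s hs) (hne2 s hs) hSa2 with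
        hU | ⟨w2, hw2, g2, hg2, hmem2⟩
      · exact Or.inl hU
      exact Or.inr ⟨w1, hw1, w2, hw2, g1, hg1, g2, hg2, hmem1, hmem2⟩

/-- IF direction of Theorem 3: under Assumption 1 and nonemptiness of
the observation maps, if `K` is conditionally decomposable and the local supervisors
satisfy `L_a(S_i^a/G_i) = P_i(K)`, then `L_a((S1^a ∧ S2^a)/G) = K` and
`L_a(S_i^a/G_i) ⊆ P_i(K)`. -/
theorem conj_eq_K_of_local_eq_proj {E : Type*} [Fintype E]
    (E1 E2 Eo Ec Eca : Set E)
    (hcover : E1 ∪ E2 = Set.univ) (hca : Eca ⊆ Ec)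
    (LG1 LG2 : Set (List E))
    (hLG1pc : PrefixClosed LG1) (hLG2pc : PrefixClosed LG2)
    (hLG1str : LG1 ⊆ Strings E1) (hLG2str : LG2 ⊆ Strings E2)
    (Phi1 Phi2 : List E → Set (List E))
    (hA1 : ∀ s ∈ sync E1 E2 LG1 LG2, Phi1 (proj E1 s) = Phi1 s)
    (hA2 : ∀ s ∈ sync E1 E2 LG1 LG2, Phi2 (proj E2 s) = Phi2 s)
    (hne1 : ∀ s ∈ sync E1 E2 LG1 LG2 ∪ LG1, (Phi1 s).Nonempty)
    (hne2 : ∀ s ∈ sync E1 E2 LG1 LG2 ∪ LG2, (Phi2 s).Nonempty)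
    (S1 S2 : List E → Set E)
    (hS1 : ∀ w, S1 w ⊆ E1) (hS2 : ∀ w, S2 w ⊆ E2)
    (K : Set (List E)) (hKsub : K ⊆ sync E1 E2 LG1 LG2)
    (hdec : K = sync E1 E2 (proj E1 '' K) (proj E2 '' K))
    (h1 : {s | LargeLang E1 LG1 Ecᶜ Phi1
        (fun w => Delta (Eca ∩ E1) (S1 w)) s} = proj E1 '' K)
    (h2 : {s | LargeLang E2 LG2 Ecᶜ Phi2
        (fun w => Delta (Eca ∩ E2) (S2 w)) s} = proj E2 '' K) :
    {s | ConjLargeLang E1 E2 (sync E1 E2 LG1 LG2) Ecᶜ Phi1 Phi2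
        (fun w => Delta (Eca ∩ E1) (S1 w)) (fun w => Delta (Eca ∩ E2) (S2 w)) s}
        = K ∧
      {s | LargeLang E1 LG1 Ecᶜ Phi1
          (fun w => Delta (Eca ∩ E1) (S1 w)) s} ⊆ proj E1 '' K ∧
      {s | LargeLang E2 LG2 Ecᶜ Phi2
          (fun w => Delta (Eca ∩ E2) (S2 w)) s} ⊆ proj E2 '' K := by
  refine ⟨?_, h1.subset, h2.subset⟩
  rw [← h1, ← h2] at hdec
  ext s
  exact (conjLargeLang_iff hA1 hA2 (fun s hs => hne1 s (Or.inl hs))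
    (fun s hs => hne2 s (Or.inl hs)) (fun _ => Delta_nonempty _ _)
    (fun _ => Delta_nonempty _ _) (hdec ▸ hKsub) s).trans (by rw [← hdec])

end DESCA

end
end
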